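/- arXiv:1904.11069 — 6 statements merged into one kernel-verified Lean document; each statement's English description precedes it below -/
import Mathlib

section
/- Let A be an m-by-n (0,1)-matrix and let t be a positive integer. Then the t-term rank of A satisfies ρ_t(A) = min{ t·e + f : there exist a set of e rows and a set of f columns of A such that every 1 of A lies in one of these e rows or one of these f columns }. -/
open Finset

/-- `A` is a `(0,1)`-matrix: every entry is `0` or `1`. -/
def IsZeroOne {m n : ℕ} (A : Matrix (Fin m) (Fin n) ℕ) : Prop :=
  ∀ i j, A i j = 0 ∨ A i j = 1

/-- The class `𝒜(R,S)` of `(0,1)`-matrices with row sum vector `R` and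
column sum vector `S`. -/
def ARS {m n : ℕ} (R : Fin m → ℕ) (S : Fin n → ℕ) :
    Set (Matrix (Fin m) (Fin n) ℕ) :=
  {A | IsZeroOne A ∧ (∀ i, ∑ j, A i j = R i) ∧ (∀ j, ∑ i, A i j = S j)}

/-- `R` and `S` are partitions of the same weight. -/
def IsPartitionPair {m n : ℕ} (R : Fin m → ℕ) (S : Fin n → ℕ) : Prop :=
  Antitone R ∧ (∀ i, 0 < R i) ∧ Antitone S ∧ (∀ j, 0 < S j) ∧
    ∑ i, R i = ∑ j, S j

/-- The rows `E` and the columns `F` cover all the `1`'s of `A`. -/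
def Covers {m n : ℕ} (A : Matrix (Fin m) (Fin n) ℕ)
    (E : Finset (Fin m)) (F : Finset (Fin n)) : Prop :=
  ∀ i j, A i j = 1 → i ∈ E ∨ j ∈ F

/-- The `t`-term rank of `A`: the maximum number of `1`'s of `A` with at most
one `1` in each column and at most `t` `1`'s in each row. -/
def tTermRank {m n : ℕ} (t : ℕ) (A : Matrix (Fin m) (Fin n) ℕ) : ℕ :=
  Finset.sup ((Finset.univ : Finset (Fin m × Fin n)).powerset.filter fun P =>
      (∀ p ∈ P, A p.1 p.2 = 1) ∧
      (∀ j : Fin n, (P.filter fun p => p.2 = j).card ≤ 1) ∧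
      (∀ i : Fin m, (P.filter fun p => p.1 = i).card ≤ t))
    Finset.card

/-- The minimum `t`-term rank over the class `𝒜(R,S)`. -/
noncomputable def minTermRank {m n : ℕ} (t : ℕ) (R : Fin m → ℕ)
    (S : Fin n → ℕ) : ℕ :=
  sInf {r : ℕ | ∃ A ∈ ARS R S, tTermRank t A = r}

/-- The structure matrix `t_{k,l}` associated with `R` and `S`
(`R`, `S` being 1-indexed in the paper, here 0-indexed):
`t_{k,l} = k·l − ∑_{j=1}^{l} S_j + ∑_{i=k+1}^{m} R_i`. -/
def structMat {m n : ℕ} (R : Fin m → ℕ) (S : Fin n → ℕ) (k l : ℕ) : ℤ :=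
  (k : ℤ) * l - ∑ j ∈ Finset.univ.filter (fun j : Fin n => (j : ℕ) < l), (S j : ℤ)
    + ∑ i ∈ Finset.univ.filter (fun i : Fin m => k ≤ (i : ℕ)), (R i : ℤ)

/-- `φ_{k,l} = min { t_{i1,l+j2} + t_{k+i2,j1} + (k−i1)(l−j1) }` over all
`0 ≤ i1 ≤ k ≤ k+i2 ≤ m` and `0 ≤ j1 ≤ l ≤ l+j2 ≤ n`. -/
noncomputable def phi {m n : ℕ} (R : Fin m → ℕ) (S : Fin n → ℕ) (k l : ℕ) : ℤ :=
  sInf {v : ℤ | ∃ i1 i2 j1 j2 : ℕ,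
    i1 ≤ k ∧ k + i2 ≤ m ∧ j1 ≤ l ∧ l + j2 ≤ n ∧
    v = structMat R S i1 (l + j2) + structMat R S (k + i2) j1
        + ((k : ℤ) - i1) * ((l : ℤ) - j1)}

/-- `ψ_{a,b;c,d}` as in the paper, the minimum being taken over all
`0 ≤ i1 ≤ a ≤ a+i2 ≤ b ≤ b+i3 ≤ m` and `0 ≤ j1 ≤ c ≤ c+j2 ≤ d ≤ d+j3 ≤ n`. -/
noncomputable def psi {m n : ℕ} (R : Fin m → ℕ) (S : Fin n → ℕ)
    (a b c d : ℕ) : ℤ :=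
  sInf {v : ℤ | ∃ i1 i2 i3 j1 j2 j3 : ℕ,
    i1 ≤ a ∧ a + i2 ≤ b ∧ b + i3 ≤ m ∧
    j1 ≤ c ∧ c + j2 ≤ d ∧ d + j3 ≤ n ∧
    v = structMat R S i1 (d + j3) + structMat R S (a + i2) (c + j2)
        + structMat R S (b + i3) j1
        + ((a : ℤ) - i1) * ((d : ℤ) - (c : ℤ) - j2)
        + ((b : ℤ) - (a : ℤ) - i2) * ((c : ℤ) - j1)
        + ((a : ℤ) - i1) * ((c : ℤ) - j1)}

/-- A set of `1`'s with at most one in each column and at most `t` in each row has at most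
`t * e + f` elements, for every cover by `e` rows and `f` columns. -/
theorem tTermRank_le_of_covers {m n : ℕ} (t : ℕ) (A : Matrix (Fin m) (Fin n) ℕ)
    {E : Finset (Fin m)} {F : Finset (Fin n)} (h : Covers A E F) :
    tTermRank t A ≤ t * E.card + F.card := by
  refine Finset.sup_le fun P hP => ?_
  obtain ⟨-, hone, hcol, hrow⟩ := Finset.mem_filter.1 hP
  have hsub : P ⊆ (E.biUnion fun i => P.filter fun p => p.1 = i) ∪
      F.biUnion fun j => P.filter fun p => p.2 = j := by
    intro p hp
    rcases h p.1 p.2 (hone p hp) with hE | hF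
    · exact mem_union_left _ (mem_biUnion.2 ⟨p.1, hE, mem_filter.2 ⟨hp, rfl⟩⟩)
    · exact mem_union_right _ (mem_biUnion.2 ⟨p.2, hF, mem_filter.2 ⟨hp, rfl⟩⟩)
  refine (card_le_card hsub).trans ((card_union_le _ _).trans (Nat.add_le_add ?_ ?_))
  · simpa [mul_comm] using card_biUnion_le_card_mul E _ t fun i _ => hrow i
  · simpa using card_biUnion_le_card_mul F _ 1 fun j _ => hcol j

/-- If every cover by `e` rows and `f` columns has `v ≤ t * e + f`, then the `t`-term rank
is at least `v`. This is the deficiency version of Hall's theorem, applied to the columns and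
`t` copies of each row. -/
theorem le_tTermRank_of_forall_covers {m n : ℕ} (t : ℕ) (A : Matrix (Fin m) (Fin n) ℕ) {v : ℕ}
    (h : ∀ E F, Covers A E F → v ≤ t * E.card + F.card) : v ≤ tTermRank t A := by
  have hvn : v ≤ n := by simpa using h ∅ univ fun _ j _ => Or.inr (mem_univ j)
  let T : Fin n → Finset ((Fin m × Fin t) ⊕ Fin (n - v)) := fun j =>
    ((univ.filter fun i => A i j = 1) ×ˢ univ).disjSum univ
  have hall : ∀ S : Finset (Fin n), S.card ≤ (S.biUnion T).card := by
    intro S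
    rcases S.eq_empty_or_nonempty with rfl | ⟨j₀, hj₀⟩
    · simp
    let N : Finset (Fin m) := S.biUnion fun j => univ.filter fun i => A i j = 1
    have hcov : v ≤ t * N.card + Sᶜ.card := h N Sᶜ fun i j hij => by
      by_cases hj : j ∈ S
      · exact Or.inl (mem_biUnion.2 ⟨j, hj, mem_filter.2 ⟨mem_univ i, hij⟩⟩)
      · exact Or.inr (mem_compl.2 hj)
    have hsub : (N ×ˢ (univ : Finset (Fin t))).disjSum (univ : Finset (Fin (n - v))) ⊆
        S.biUnion T := by
      rintro (⟨i, k⟩ | d) hx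
      · obtain ⟨j, hj, hij⟩ : ∃ j ∈ S, A i j = 1 := by simpa [N] using hx
        exact mem_biUnion.2 ⟨j, hj, by simpa [T] using hij⟩
      · exact mem_biUnion.2 ⟨j₀, hj₀, by simp [T]⟩
    have hcard := card_le_card hsub
    simp only [card_disjSum, card_product, card_univ, Fintype.card_fin] at hcard
    rw [card_compl, Fintype.card_fin] at hcov
    have hSn : S.card ≤ n := by simpa using card_le_univ S
    rw [mul_comm] at hcard
    omega
  obtain ⟨f, hf, hfT⟩ := (Finset.all_card_le_biUnion_card_iff_exists_injective T).1 hall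
  let P : Finset (Fin m × Fin n) := univ.filter fun p => ∃ k, f p.2 = Sum.inl (p.1, k)
  have hP {p : Fin m × Fin n} : p ∈ P ↔ ∃ k, f p.2 = Sum.inl (p.1, k) := by simp [P]
  have hcol : ∀ j : Fin n, (P.filter fun p => p.2 = j).card ≤ 1 := by
    intro j
    refine card_le_one.2 ?_
    intro p hp q hq
    obtain ⟨hpP, hpj⟩ := mem_filter.1 hp
    obtain ⟨hqP, hqj⟩ := mem_filter.1 hq
    obtain ⟨k, hk⟩ := hP.1 hpP
    obtain ⟨k', hk'⟩ := hP.1 hqP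
    rw [hpj] at hk
    rw [hqj, hk] at hk'
    exact Prod.ext (Prod.ext_iff.1 (Sum.inl_injective hk')).1 (hpj.trans hqj.symm)
  have hrow : ∀ i : Fin m, (P.filter fun p => p.1 = i).card ≤ t := by
    intro i
    have hle : (P.filter fun p => p.1 = i).card ≤
        ((univ : Finset (Fin t)).image fun k =>
          (Sum.inl (i, k) : (Fin m × Fin t) ⊕ Fin (n - v))).card := by
      refine card_le_card_of_injOn (fun p => f p.2) ?_ ?_
      · intro p hp
        obtain ⟨hpP, rfl⟩ := mem_filter.1 hp
        obtain ⟨k, hk⟩ := hP.1 hpP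
        exact mem_coe.2 (mem_image.2 ⟨k, mem_univ k, hk.symm⟩)
      · intro p hp q hq hpq
        exact Prod.ext ((mem_filter.1 hp).2.trans (mem_filter.1 hq).2.symm) (hf hpq)
    exact hle.trans (card_image_le.trans (by simp))
  have hone : ∀ p ∈ P, A p.1 p.2 = 1 := by
    intro p hp
    obtain ⟨k, hk⟩ := hP.1 hp
    have := hfT p.2
    rw [hk] at this
    simpa [T] using this
  have hunmatched : (P.image Prod.snd)ᶜ.card ≤ n - v := by
    have hle : (P.image Prod.snd)ᶜ.card ≤ ((univ : Finset (Fin (n - v))).image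
        (Sum.inr : _ → (Fin m × Fin t) ⊕ Fin (n - v))).card := by
      refine card_le_card_of_injOn f ?_ hf.injOn
      intro j hj
      rcases hfj : f j with ⟨i, k⟩ | d
      · exact absurd (mem_image.2 ⟨(i, j), hP.2 ⟨k, hfj⟩, rfl⟩) (mem_compl.1 hj)
      · simp
    exact hle.trans (card_image_le.trans (by simp))
  have hPv : v ≤ P.card := by
    have hle : (P.image Prod.snd).card ≤ P.card := card_image_le
    rw [card_compl, Fintype.card_fin] at hunmatched
    omega
  exact hPv.trans (Finset.le_sup (f := Finset.card)
    (mem_filter.2 ⟨mem_powerset.2 (subset_univ P), hone, hcol, hrow⟩))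

/-- Generalized Kőnig–Egerváry theorem (Proposition `te+f` of the paper):
the `t`-term rank of a `(0,1)`-matrix `A` equals the minimum of `t·e + f`
over all covers of `A` with `e` rows and `f` columns. -/
theorem tTermRank_eq_min_cover {m n : ℕ} (t : ℕ) (ht : 0 < t)
    (A : Matrix (Fin m) (Fin n) ℕ) (hA : IsZeroOne A) :
    tTermRank t A =
      sInf {v : ℕ | ∃ (E : Finset (Fin m)) (F : Finset (Fin n)),
        Covers A E F ∧ v = t * E.card + F.card} := by
  apply le_antisymm
  · refine le_csInf ⟨_, ∅, univ, fun _ j _ => Or.inr (mem_univ j), rfl⟩ ?_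
    rintro _ ⟨E, F, h, rfl⟩
    exact tTermRank_le_of_covers t A h
  · exact le_tTermRank_of_forall_covers t A fun E F h => Nat.sInf_le ⟨E, F, h, rfl⟩
end

section
/- Let R=(R_1,…,R_m) and S=(S_1,…,S_n) be partitions of the same weight such that A(R,S) is nonempty, and let e,f be integers with 0≤e≤m and 0≤f≤n. Then there exists a matrix in A(R,S) all of whose 1's are contained in the union of its first e rows and first f columns if and only if φ_{e,f} = t_{e,f}. -/
open Finset

/-- The sum of `g` over the indices less than `k`. -/
def prefixSum {m : ℕ} (g : Fin m → ℕ) (k : ℕ) : ℕ :=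
  ∑ i ∈ Finset.univ.filter (fun i : Fin m => (i : ℕ) < k), g i

theorem sum_filter_Ico_add_prefixSum {m : ℕ} (g : Fin m → ℕ) {a b : ℕ} (hab : a ≤ b) :
    ∑ i ∈ Finset.univ.filter (fun i : Fin m => a ≤ (i : ℕ) ∧ (i : ℕ) < b), g i + prefixSum g a =
      prefixSum g b := by
  unfold prefixSum
  rw [← Finset.sum_union]
  · congr 1
    ext i
    simp
    omega
  · rw [Finset.disjoint_left]
    intro i
    simp
    omega

theorem card_filter_Ico_fin {m a b : ℕ} (hb : b ≤ m) :
    (Finset.univ.filter (fun i : Fin m => a ≤ (i : ℕ) ∧ (i : ℕ) < b)).card = b - a := by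
  rw [← Finset.card_map Fin.valEmbedding, ← Nat.card_Ico]
  congr 1
  ext x
  simp only [Finset.mem_map, Finset.mem_filter, Finset.mem_univ, true_and,
    Fin.valEmbedding_apply, Finset.mem_Ico]
  exact ⟨by rintro ⟨i, hi, rfl⟩; exact hi, fun h => ⟨⟨x, by omega⟩, h, rfl⟩⟩

/-- Among the sets of given cardinality of indices `≥ a`, an antitone function has the largest
sum over the initial one. -/
theorem sum_add_prefixSum_le {m : ℕ} {g : Fin m → ℕ} (hg : Antitone g) (a : ℕ)
    (I : Finset (Fin m)) (hI : ∀ i ∈ I, a ≤ (i : ℕ)) :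
    ∑ i ∈ I, g i + prefixSum g a ≤ prefixSum g (a + I.card) := by
  induction I using Finset.induction_on_max with
  | empty => simp
  | insert x I hx ih =>
    have hxI : x ∉ I := fun h => lt_irrefl _ (hx x h)
    have hax := hI x (Finset.mem_insert_self _ _)
    have hcard : a + I.card ≤ (x : ℕ) := by
      have h : I ⊆ Finset.univ.filter
          (fun i : Fin m => a ≤ (i : ℕ) ∧ (i : ℕ) < (x : ℕ)) := fun i hi => by
        simpa using ⟨hI i (Finset.mem_insert_of_mem hi), hx i hi⟩
      have := Finset.card_le_card h
      rw [card_filter_Ico_fin x.2.le] at this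
      omega
    have hlt : a + I.card < m := hcard.trans_lt x.2
    have hsucc : prefixSum g (a + I.card + 1) =
        g ⟨a + I.card, hlt⟩ + prefixSum g (a + I.card) := by
      rw [← sum_filter_Ico_add_prefixSum g (Nat.le_succ (a + I.card))]
      congr 1
      rw [Finset.sum_eq_single ⟨a + I.card, hlt⟩]
      · intro i hi hne
        simp only [Finset.mem_filter, Finset.mem_univ, true_and] at hi
        exact absurd (Fin.ext (by simp only; omega)) hne
      · simp
    have hle : g x ≤ g ⟨a + I.card, hlt⟩ := hg (Fin.le_def.2 hcard)
    have := ih fun i hi => hI i (Finset.mem_insert_of_mem hi)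
    rw [Finset.sum_insert hxI, Finset.card_insert_of_notMem hxI, ← add_assoc, hsucc]
    omega

theorem structMat_eq {m n : ℕ} (R : Fin m → ℕ) (S : Fin n → ℕ) (k l : ℕ) :
    structMat R S k l =
      (k : ℤ) * l - prefixSum S l + ((∑ i, R i : ℕ) - prefixSum R k : ℤ) := by
  have h := Finset.sum_filter_add_sum_filter_not Finset.univ
    (fun i : Fin m => (i : ℕ) < k) R
  simp only [not_lt] at h
  unfold structMat prefixSum
  rw [← h]
  push_cast
  ring

/-- A relation `Q` between two finite types contains a subrelation with prescribed (equal-sum)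
row and column sums as soon as the cut conditions hold. -/
theorem exists_subrelation_of_cut {α β : Type*} [Fintype α] [Fintype β] [DecidableEq α]
    [DecidableEq β] (Q : Finset (α × β)) (r : α → ℕ) (s : β → ℕ)
    (hrs : ∑ i, r i = ∑ j, s j)
    (hcut : ∀ (I : Finset α) (J : Finset β),
      ∑ j ∈ J, s j + ∑ i ∈ I, r i ≤ ∑ i, r i + ((I ×ˢ J).filter (· ∈ Q)).card) :
    ∃ M ⊆ Q, (∀ i, (M.filter (·.1 = i)).card = r i) ∧
      ∀ j, (M.filter (·.2 = j)).card = s j := by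
  classical
  -- Split each cell of `Q` into a left and a right vertex and apply Hall's theorem.
  let N : ((Σ j, Fin (s j)) ⊕ Q) → Finset (Q ⊕ (Σ i, Fin (r i))) := Sum.elim
    (fun t => Finset.univ.filter fun y => ∃ q : Q, y = Sum.inl q ∧ q.1.2 = t.1)
    (fun q => Finset.univ.filter fun y =>
      y = Sum.inl q ∨ ∃ u : (Σ i, Fin (r i)), y = Sum.inr u ∧ u.1 = q.1.1)
  have hall : ∀ X : Finset ((Σ j, Fin (s j)) ⊕ Q), X.card ≤ (X.biUnion N).card := by
    intro X
    set T := X.toLeft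
    set E := X.toRight
    set J : Finset β := T.image (·.1) with hJ
    set K : Finset α := E.image (·.1.1) with hK
    have hTJ : T.card ≤ ∑ j ∈ J, s j := by
      calc T.card ≤ (J.sigma fun j => (Finset.univ : Finset (Fin (s j)))).card :=
            Finset.card_le_card fun t ht => by
              simpa [hJ] using ⟨t.2, ht⟩
        _ = ∑ j ∈ J, s j := by simp
    have hI := hcut Kᶜ J
    have hsplit := Finset.sum_add_sum_compl K r
    let G : Finset Q := Finset.univ.filter fun q => q.1.1 ∉ K ∧ q.1.2 ∈ J
    have hG : ((Kᶜ ×ˢ J).filter (· ∈ Q)).card = G.card := by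
      rw [← Finset.card_map (Function.Embedding.subtype (· ∈ Q))]
      congr 1
      ext ⟨a, b⟩
      simp [G]
    have hdisj : Disjoint E G := by
      rw [Finset.disjoint_left]
      intro q hq hqG
      simp only [G, Finset.mem_filter] at hqG
      exact hqG.2.1 (Finset.mem_image_of_mem (·.1.1) hq)
    have hsub : (E ∪ G).disjSum (K.sigma fun i => (Finset.univ : Finset (Fin (r i)))) ⊆
        X.biUnion N := by
      intro y hy
      rw [Finset.mem_biUnion]
      rcases y with q | u
      · rw [Finset.inl_mem_disjSum, Finset.mem_union] at hy
        rcases hy with hq | hq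
        · exact ⟨Sum.inr q, Finset.mem_toRight.1 hq, by simp [N]⟩
        · simp only [G, Finset.mem_filter, hJ, Finset.mem_image] at hq
          obtain ⟨-, -, t, ht, htq⟩ := hq
          exact ⟨Sum.inl t, Finset.mem_toLeft.1 ht,
            Finset.mem_filter.2 ⟨Finset.mem_univ _, q, rfl, htq.symm⟩⟩
      · rw [Finset.inr_mem_disjSum, Finset.mem_sigma] at hy
        obtain ⟨q, hq, hqu⟩ := Finset.mem_image.1 hy.1
        exact ⟨Sum.inr q, Finset.mem_toRight.1 hq,
          Finset.mem_filter.2 ⟨Finset.mem_univ _, Or.inr ⟨u, rfl, hqu.symm⟩⟩⟩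
    have hcard := Finset.card_le_card hsub
    rw [Finset.card_disjSum, Finset.card_union_of_disjoint hdisj, Finset.card_sigma] at hcard
    simp only [Finset.card_univ, Fintype.card_fin] at hcard
    have hX : X.card = T.card + E.card := (Finset.card_toLeft_add_card_toRight).symm
    omega
  obtain ⟨φ, hinj, hφ⟩ := (Finset.all_card_le_biUnion_card_iff_exists_injective N).1 hall
  have hφl : ∀ t : (Σ j, Fin (s j)), ∃ q : Q, φ (Sum.inl t) = Sum.inl q ∧ q.1.2 = t.1 :=
    fun t => (Finset.mem_filter.1 (hφ (Sum.inl t))).2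
  choose c hc hcol using hφl
  have hcinj : Function.Injective c := fun t t' h => by
    have := hinj ((hc t).trans (h ▸ (hc t').symm))
    exact Sum.inl.inj this
  have hφr : ∀ t, ∃ u : (Σ i, Fin (r i)), φ (Sum.inr (c t)) = Sum.inr u ∧ u.1 = (c t).1.1 :=
    fun t => by
      have h := (Finset.mem_filter.1 (hφ (Sum.inr (c t)))).2
      exact h.resolve_left fun h => by simpa using hinj (h.trans (hc t).symm)
  choose d hd hrow using hφr
  have hdinj : Function.Injective d := fun t t' h => by
    have := hinj ((hd t).trans (h ▸ (hd t').symm))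
    exact hcinj (Sum.inr.inj this)
  let M : Finset (α × β) := Finset.univ.image fun t => (c t).1
  have hcinj' : Function.Injective fun t => (c t).1 := Subtype.val_injective.comp hcinj
  have hcolM : ∀ j, (M.filter (·.2 = j)).card = s j := by
    intro j
    rw [Finset.filter_image, Finset.card_image_of_injective _ hcinj']
    have : (Finset.univ.filter fun t : (Σ j, Fin (s j)) => (c t).1.2 = j) =
        ({j} : Finset β).sigma fun j => (Finset.univ : Finset (Fin (s j))) := by
      ext t
      simp [hcol]
    rw [this]
    simp
  have hrowM : ∀ i, (M.filter (·.1 = i)).card ≤ r i := by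
    intro i
    rw [Finset.filter_image, Finset.card_image_of_injective _ hcinj',
      ← Finset.card_image_of_injective _ hdinj]
    calc _ ≤ (({i} : Finset α).sigma fun i => (Finset.univ : Finset (Fin (r i)))).card := by
          apply Finset.card_le_card
          intro u hu
          simp only [Finset.mem_image, Finset.mem_filter, Finset.mem_univ, true_and] at hu
          obtain ⟨t, ht, rfl⟩ := hu
          simp [hrow, ht]
      _ = r i := by simp
  refine ⟨M, fun p hp => ?_, ?_, hcolM⟩
  · obtain ⟨t, -, rfl⟩ := Finset.mem_image.1 hp
    exact (c t).2
  · have h1 : ∑ i, (M.filter (·.1 = i)).card = M.card :=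
      (Finset.card_eq_sum_card_fiberwise fun _ _ => Finset.mem_univ _).symm
    have h2 : ∑ j, (M.filter (·.2 = j)).card = M.card :=
      (Finset.card_eq_sum_card_fiberwise fun _ _ => Finset.mem_univ _).symm
    have h3 : ∑ i, (M.filter (·.1 = i)).card = ∑ i, r i := by
      rw [h1, ← h2, hrs]
      exact Finset.sum_congr rfl fun j _ => hcolM j
    exact fun i => (Finset.sum_eq_sum_iff_of_le fun i _ => hrowM i).1 h3 i (Finset.mem_univ i)

/-- The class `𝒜(R,S)` has a matrix supported in `Q` iff the cut conditions hold. -/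
theorem exists_mem_ARS_supported_iff {m n : ℕ} (R : Fin m → ℕ) (S : Fin n → ℕ)
    (hRS : ∑ i, R i = ∑ j, S j) (Q : Finset (Fin m × Fin n)) :
    (∃ A ∈ ARS R S, ∀ i j, A i j = 1 → (i, j) ∈ Q) ↔
      ∀ (I : Finset (Fin m)) (J : Finset (Fin n)),
        ∑ j ∈ J, S j + ∑ i ∈ I, R i ≤ ∑ i, R i + ((I ×ˢ J).filter (· ∈ Q)).card := by
  constructor
  · rintro ⟨A, ⟨h01, hR, hS⟩, hQ⟩ I J
    have hblock : ∑ i ∈ I, ∑ j ∈ J, A i j ≤ ((I ×ˢ J).filter (· ∈ Q)).card := by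
      refine (Finset.sum_product' I J fun i j => A i j).ge.trans ?_
      rw [Finset.card_filter]
      refine Finset.sum_le_sum fun p _ => ?_
      rcases h01 p.1 p.2 with h | h
      · simp [h]
      · simp [h, hQ _ _ h]
    have hcompl : ∑ i ∈ Iᶜ, ∑ j ∈ J, A i j ≤ ∑ i ∈ Iᶜ, R i :=
      Finset.sum_le_sum fun i _ => (Finset.sum_le_univ_sum_of_nonneg fun _ => Nat.zero_le _).trans
        (hR i).le
    have hsumS : ∑ j ∈ J, S j = ∑ i ∈ I, ∑ j ∈ J, A i j + ∑ i ∈ Iᶜ, ∑ j ∈ J, A i j := by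
      rw [Finset.sum_add_sum_compl]
      exact (Finset.sum_congr rfl fun j _ => (hS j).symm).trans Finset.sum_comm
    have := Finset.sum_add_sum_compl I R
    omega
  · intro hcut
    obtain ⟨M, hMQ, hrow, hcol⟩ := exists_subrelation_of_cut Q R S hRS hcut
    refine ⟨fun i j => if (i, j) ∈ M then 1 else 0, ⟨fun i j => ?_, fun i => ?_, fun j => ?_⟩,
      fun i j h => hMQ (by simpa using h)⟩
    · by_cases h : (i, j) ∈ M <;> simp [h]
    · rw [← hrow i, ← Finset.card_filter]
      refine Finset.card_bij (fun j _ => (i, j)) ?_ ?_ ?_ <;> aesop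
    · rw [← hcol j, ← Finset.card_filter]
      refine Finset.card_bij (fun i _ => (i, j)) ?_ ?_ ?_ <;> aesop

theorem card_product_filter_or {α β : Type*} (I : Finset α) (J : Finset β)
    (p : α → Prop) (q : β → Prop) [DecidablePred p] [DecidablePred q] :
    ((I ×ˢ J).filter fun x => p x.1 ∨ q x.2).card =
      (I.filter p).card * J.card + (I.filter (¬ p ·)).card * (J.filter q).card := by
  classical
  rw [← Finset.card_product, ← Finset.card_product, ← Finset.card_union_of_disjoint]
  · congr 1
    ext x
    simp only [Finset.mem_filter, Finset.mem_union, Finset.mem_product]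
    tauto
  · rw [Finset.disjoint_left]
    intro x
    simp only [Finset.mem_filter, Finset.mem_product]
    tauto

theorem bddBelow_phi_set {m n : ℕ} (R : Fin m → ℕ) (S : Fin n → ℕ) (k l : ℕ) :
    BddBelow {v : ℤ | ∃ i1 i2 j1 j2 : ℕ,
      i1 ≤ k ∧ k + i2 ≤ m ∧ j1 ≤ l ∧ l + j2 ≤ n ∧
      v = structMat R S i1 (l + j2) + structMat R S (k + i2) j1
        + ((k : ℤ) - i1) * ((l : ℤ) - j1)} := by
  have hlow : ∀ a b, -((∑ j, S j : ℕ) : ℤ) ≤ structMat R S a b := by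
    intro a b
    have h1 : prefixSum S b ≤ ∑ j, S j := Finset.sum_le_univ_sum_of_nonneg fun _ => Nat.zero_le _
    have h2 : prefixSum R a ≤ ∑ i, R i := Finset.sum_le_univ_sum_of_nonneg fun _ => Nat.zero_le _
    have h3 : (0 : ℤ) ≤ (a : ℤ) * b := by positivity
    rw [structMat_eq]
    omega
  refine ⟨-(2 * (∑ j, S j : ℕ)), ?_⟩
  rintro _ ⟨i1, i2, j1, j2, hi1, -, hj1, -, rfl⟩
  have h1 := hlow i1 (l + j2)
  have h2 := hlow (k + i2) j1
  have h3 : (0 : ℤ) ≤ ((k : ℤ) - i1) * ((l : ℤ) - j1) :=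
    mul_nonneg (by omega) (by omega)
  omega

theorem phi_eq_structMat_iff {m n : ℕ} (R : Fin m → ℕ) (S : Fin n → ℕ) {k l : ℕ}
    (hk : k ≤ m) (hl : l ≤ n) :
    phi R S k l = structMat R S k l ↔ ∀ i1 i2 j1 j2 : ℕ,
      i1 ≤ k → k + i2 ≤ m → j1 ≤ l → l + j2 ≤ n →
      structMat R S k l ≤ structMat R S i1 (l + j2) + structMat R S (k + i2) j1
        + ((k : ℤ) - i1) * ((l : ℤ) - j1) := by
  constructor
  · intro h i1 i2 j1 j2 hi1 hi2 hj1 hj2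
    rw [← h]
    exact csInf_le (bddBelow_phi_set R S k l) ⟨i1, i2, j1, j2, hi1, hi2, hj1, hj2, rfl⟩
  · intro h
    refine IsLeast.csInf_eq ⟨⟨k, m - k, 0, 0, le_rfl, by omega, Nat.zero_le _, by omega, ?_⟩, ?_⟩
    · rw [show k + (m - k) = m by omega, structMat_eq R S m 0]
      simp [prefixSum]
    · rintro _ ⟨i1, i2, j1, j2, hi1, hi2, hj1, hj2, rfl⟩
      exact h i1 i2 j1 j2 hi1 hi2 hj1 hj2

/-- The difference of the two sides of the inequality defining `phi`, as a cut condition. -/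
theorem structMat_le_iff {m n : ℕ} (R : Fin m → ℕ) (S : Fin n → ℕ) (k l i1 i2 j1 j2 : ℕ) :
    structMat R S k l ≤ structMat R S i1 (l + j2) + structMat R S (k + i2) j1
        + ((k : ℤ) - i1) * ((l : ℤ) - j1) ↔
      prefixSum S j1 + prefixSum S (l + j2) + prefixSum R i1 + prefixSum R (k + i2) ≤
        ∑ i, R i + (i1 * (j1 + j2) + i2 * j1) + prefixSum S l + prefixSum R k := by
  simp only [structMat_eq]
  zify
  constructor <;> intro h <;> linarith

theorem sum_two_initial_segments {m : ℕ} (g : Fin m → ℕ) {e i1 i2 : ℕ} (hi1 : i1 ≤ e) :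
    ∑ i ∈ Finset.univ.filter
        (fun i : Fin m => (i : ℕ) < i1 ∨ e ≤ (i : ℕ) ∧ (i : ℕ) < e + i2), g i + prefixSum g e =
      prefixSum g i1 + prefixSum g (e + i2) := by
  rw [← sum_filter_Ico_add_prefixSum g (Nat.le_add_right e i2), Finset.filter_or,
    Finset.sum_union, prefixSum, prefixSum, add_assoc]
  rw [Finset.disjoint_left]
  intro i
  simp
  omega

theorem card_two_initial_segments_lt {m e i1 i2 : ℕ} (hi1 : i1 ≤ e) (he : e ≤ m) :
    ((Finset.univ.filter
        (fun i : Fin m => (i : ℕ) < i1 ∨ e ≤ (i : ℕ) ∧ (i : ℕ) < e + i2)).filter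
      fun i : Fin m => (i : ℕ) < e).card = i1 := by
  have h := card_filter_Ico_fin (a := 0) (hi1.trans he)
  rw [Nat.sub_zero] at h
  rw [Finset.filter_filter]
  refine Eq.trans (congrArg Finset.card ?_) h
  ext i
  simp
  omega

theorem card_two_initial_segments_not_lt {m e i1 i2 : ℕ} (hi1 : i1 ≤ e) (hi2 : e + i2 ≤ m) :
    ((Finset.univ.filter
        (fun i : Fin m => (i : ℕ) < i1 ∨ e ≤ (i : ℕ) ∧ (i : ℕ) < e + i2)).filter
      fun i : Fin m => ¬ (i : ℕ) < e).card = i2 := by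
  have h := card_filter_Ico_fin (a := e) hi2
  rw [Nat.add_sub_cancel_left] at h
  rw [Finset.filter_filter]
  refine Eq.trans (congrArg Finset.card ?_) h
  ext i
  simp
  omega

theorem card_filter_lt_le {m : ℕ} (I : Finset (Fin m)) {e : ℕ} (he : e ≤ m) :
    (I.filter fun i : Fin m => (i : ℕ) < e).card ≤ e := by
  have h := card_filter_Ico_fin (a := 0) he
  rw [Nat.sub_zero] at h
  refine (Finset.card_le_card fun i hi => ?_).trans h.le
  simpa using (Finset.mem_filter.1 hi).2

theorem add_card_filter_not_lt_le {m : ℕ} (I : Finset (Fin m)) {e : ℕ} (he : e ≤ m) :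
    e + (I.filter fun i : Fin m => ¬ (i : ℕ) < e).card ≤ m := by
  have h := card_filter_Ico_fin (a := e) (le_refl m)
  have : (I.filter fun i : Fin m => ¬ (i : ℕ) < e).card ≤ m - e := by
    refine (Finset.card_le_card fun i hi => ?_).trans h.le
    simpa using (Finset.mem_filter.1 hi).2
  omega

theorem sum_add_prefixSum_le_of_split {m : ℕ} {g : Fin m → ℕ} (hg : Antitone g) (e : ℕ)
    (I : Finset (Fin m)) :
    ∑ i ∈ I, g i + prefixSum g e ≤ prefixSum g (I.filter fun i : Fin m => (i : ℕ) < e).card +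
      prefixSum g (e + (I.filter fun i : Fin m => ¬ (i : ℕ) < e).card) := by
  have h1 := sum_add_prefixSum_le hg 0 (I.filter fun i : Fin m => (i : ℕ) < e) fun _ _ => Nat.zero_le _
  have h2 := sum_add_prefixSum_le hg e (I.filter fun i : Fin m => ¬ (i : ℕ) < e)
    fun i hi => not_lt.1 (Finset.mem_filter.1 hi).2
  have h3 := Finset.sum_filter_add_sum_filter_not I (fun i : Fin m => (i : ℕ) < e) g
  rw [zero_add] at h1
  omega

/-- There is a matrix in `𝒜(R,S)` all of whose `1`'s are contained in the
union of its first `e` rows and first `f` columns iff `φ_{e,f} = t_{e,f}`. -/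
theorem exists_matrix_first_rows_cols_iff {m n : ℕ} (R : Fin m → ℕ)
    (S : Fin n → ℕ) (hRS : IsPartitionPair R S) (hne : (ARS R S).Nonempty)
    (e f : ℕ) (he : e ≤ m) (hf : f ≤ n) :
    (∃ A ∈ ARS R S, ∀ i j, A i j = 1 → (i : ℕ) < e ∨ (j : ℕ) < f) ↔
      phi R S e f = structMat R S e f := by
  obtain ⟨hR, -, hS, -, hsum⟩ := hRS
  let Q : Finset (Fin m × Fin n) := Finset.univ.filter fun x => (x.1 : ℕ) < e ∨ (x.2 : ℕ) < f
  have hQ : (∃ A ∈ ARS R S, ∀ i j, A i j = 1 → (i : ℕ) < e ∨ (j : ℕ) < f) ↔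
      ∃ A ∈ ARS R S, ∀ i j, A i j = 1 → (i, j) ∈ Q := by simp [Q]
  have hcard : ∀ (I : Finset (Fin m)) (J : Finset (Fin n)),
      ((I ×ˢ J).filter (· ∈ Q)).card =
        (I.filter fun i : Fin m => (i : ℕ) < e).card *
          ((J.filter fun j : Fin n => (j : ℕ) < f).card + (J.filter fun j : Fin n => ¬ (j : ℕ) < f).card) +
        (I.filter fun i : Fin m => ¬ (i : ℕ) < e).card * (J.filter fun j : Fin n => (j : ℕ) < f).card := by
    intro I J
    rw [Finset.card_filter_add_card_filter_not, ← card_product_filter_or]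
    simp [Q]
  rw [hQ, exists_mem_ARS_supported_iff R S hsum, phi_eq_structMat_iff R S he hf]
  simp only [structMat_le_iff, hcard]
  constructor
  · intro h i1 i2 j1 j2 hi1 hi2 hj1 hj2
    have key := h
      (Finset.univ.filter fun i : Fin m => (i : ℕ) < i1 ∨ e ≤ (i : ℕ) ∧ (i : ℕ) < e + i2)
      (Finset.univ.filter fun j : Fin n => (j : ℕ) < j1 ∨ f ≤ (j : ℕ) ∧ (j : ℕ) < f + j2)
    have hR' := sum_two_initial_segments (i2 := i2) R hi1
    have hS' := sum_two_initial_segments (i2 := j2) S hj1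
    rw [card_two_initial_segments_lt hi1 he, card_two_initial_segments_not_lt hi1 hi2,
      card_two_initial_segments_lt hj1 hf, card_two_initial_segments_not_lt hj1 hj2] at key
    omega
  · intro h I J
    have key := h (I.filter fun i : Fin m => (i : ℕ) < e).card (I.filter fun i : Fin m => ¬ (i : ℕ) < e).card
      (J.filter fun j : Fin n => (j : ℕ) < f).card (J.filter fun j : Fin n => ¬ (j : ℕ) < f).card
      (card_filter_lt_le I he) (add_card_filter_not_lt_le I he)
      (card_filter_lt_le J hf) (add_card_filter_not_lt_le J hf)
    have hR' := sum_add_prefixSum_le_of_split hR e I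
    have hS' := sum_add_prefixSum_le_of_split hS f J
    omega
end

section
/- Let (R_1,…,R_m) and (S_1,…,S_n) be two sequences of nonnegative integers with ∑_i R_i = ∑_j S_j, and let C=[c_{i,j}] be an m-by-n nonnegative integral matrix. Then there exists a nonnegative integral m-by-n matrix A=[a_{i,j}] with 0 ≤ a_{i,j} ≤ c_{i,j} for all i,j, with i-th row sum equal to R_i for every i, and with j-th column sum equal to S_j for every j, if and only if for all subsets I ⊆ {1,…,m} and J ⊆ {1,…,n} one has ∑_{i∈I, j∈J} c_{i,j} ≥ ∑_{j∈J} S_j − ∑_{i∉I} R_i. -/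
open Finset

section BoundedMatrix

variable {α β : Type*} [Fintype α] [DecidableEq α] [DecidableEq β]

/-- In the transportation network with supplies `R`, demands `S` and capacities `c`, where total
supply equals total demand, the amount by which the capacity of the cut given by `I` and `J`
exceeds the total demand. -/
def cutExcess (c : α → β → ℤ) (R : α → ℤ) (S : β → ℤ) (I : Finset α) (J : Finset β) : ℤ :=
  ∑ i ∈ I, ∑ j ∈ J, c i j + ∑ i ∈ Iᶜ, R i - ∑ j ∈ J, S j

theorem cutExcess_submodular [Fintype β] {c : α → β → ℤ} (hc : ∀ i j, 0 ≤ c i j)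
    (R : α → ℤ) (S : β → ℤ) (I I' : Finset α) (J J' : Finset β) :
    cutExcess c R S (I ∪ I') (J ∩ J') + cutExcess c R S (I ∩ I') (J ∪ J') ≤
      cutExcess c R S I J + cutExcess c R S I' J' := by
  have hS : ∑ j ∈ J ∪ J', S j + ∑ j ∈ J ∩ J', S j = ∑ j ∈ J, S j + ∑ j ∈ J', S j :=
    Finset.sum_union_inter
  have hR : ∑ i ∈ Iᶜ ∪ I'ᶜ, R i + ∑ i ∈ Iᶜ ∩ I'ᶜ, R i = ∑ i ∈ Iᶜ, R i + ∑ i ∈ I'ᶜ, R i :=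
    Finset.sum_union_inter
  rw [← Finset.compl_inter, ← Finset.compl_union] at hR
  have indicator (K : Finset α) (L : Finset β) : ∑ i ∈ K, ∑ j ∈ L, c i j =
      ∑ i, ∑ j, if i ∈ K ∧ j ∈ L then c i j else 0 := by
    simp [ite_and, Finset.sum_ite_mem]
  have hc' : ∑ i ∈ I ∪ I', ∑ j ∈ J ∩ J', c i j + ∑ i ∈ I ∩ I', ∑ j ∈ J ∪ J', c i j ≤
      ∑ i ∈ I, ∑ j ∈ J, c i j + ∑ i ∈ I', ∑ j ∈ J', c i j := by
    simp only [indicator, ← Finset.sum_add_distrib]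
    refine Finset.sum_le_sum fun i _ => Finset.sum_le_sum fun j _ => ?_
    have := hc i j
    simp only [Finset.mem_union, Finset.mem_inter]
    grind
  unfold cutExcess
  linarith

theorem cutExcess_sub_single_capacity (c : α → β → ℤ) (R : α → ℤ) (S : β → ℤ) (p : α) (q : β)
    (I : Finset α) (J : Finset β) :
    cutExcess (c - Pi.single p (Pi.single q 1)) R S I J =
      cutExcess c R S I J - if p ∈ I ∧ q ∈ J then 1 else 0 := by
  have hsum : ∑ i ∈ I, ∑ j ∈ J, (Pi.single p (Pi.single q 1) : α → β → ℤ) i j =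
      if p ∈ I ∧ q ∈ J then 1 else 0 := by
    simp only [Pi.single_apply, ite_apply, Pi.zero_apply]
    by_cases hp : p ∈ I <;> by_cases hq : q ∈ J <;> simp [hp, hq, Finset.sum_ite_irrel]
  simp only [cutExcess, Pi.sub_apply, Finset.sum_sub_distrib, hsum]
  ring

theorem cutExcess_sub_single (c : α → β → ℤ) (R : α → ℤ) (S : β → ℤ) (p : α) (q : β)
    (I : Finset α) (J : Finset β) :
    cutExcess c (R - Pi.single p 1) (S - Pi.single q 1) I J =
      cutExcess c R S I J - (if p ∈ I then 0 else 1) + if q ∈ J then 1 else 0 := by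
  simp only [cutExcess, Pi.sub_apply, Finset.sum_sub_distrib, Finset.sum_pi_single',
    Finset.mem_compl, ite_not]
  ring

theorem exists_int_matrix_of_cutExcess_nonneg [Fintype β] (c : α → β → ℤ) (R : α → ℤ)
    (S : β → ℤ) (h : ∑ i, R i = ∑ j, S j) (hc : ∀ i j, 0 ≤ c i j)
    (hcut : ∀ I J, 0 ≤ cutExcess c R S I J) :
    ∃ A : α → β → ℤ, (∀ i j, 0 ≤ A i j) ∧ (∀ i j, A i j ≤ c i j) ∧
      (∀ i, ∑ j, A i j = R i) ∧ ∀ j, ∑ i, A i j = S j := by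
  obtain ⟨N, hN⟩ : ∃ N : ℕ, ∑ i, ∑ j, c i j ≤ N := ⟨_, Int.self_le_toNat _⟩
  induction N generalizing c R S with
  | zero =>
    have hc0 (i j) : c i j = 0 := by
      have h0 : ∑ i, ∑ j, c i j = 0 :=
        le_antisymm hN (Finset.sum_nonneg fun i _ => Finset.sum_nonneg fun j _ => hc i j)
      have hi := (Finset.sum_eq_zero_iff_of_nonneg
        fun i _ => Finset.sum_nonneg fun j _ => hc i j).1 h0 i (Finset.mem_univ i)
      exact (Finset.sum_eq_zero_iff_of_nonneg fun j _ => hc i j).1 hi j (Finset.mem_univ j)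
    have hR (i) : 0 ≤ R i := by simpa [cutExcess] using hcut {i}ᶜ ∅
    have hS (j) : 0 ≤ S j := by
      have hj := hcut ∅ {j}ᶜ
      have := Finset.sum_compl_add_sum {j} S
      simp only [Finset.sum_singleton] at this
      simp only [cutExcess, Finset.sum_empty, Finset.compl_empty] at hj
      linarith
    have hS0 : ∑ j, S j = 0 := by
      have := hcut Finset.univ Finset.univ
      simp only [cutExcess, hc0, Finset.compl_univ, Finset.sum_empty, Finset.sum_const_zero] at this
      exact le_antisymm (by linarith) (Finset.sum_nonneg fun j _ => hS j)
    refine ⟨0, fun _ _ => le_rfl, hc, fun i => ?_, fun j => ?_⟩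
    · have := (Finset.sum_eq_zero_iff_of_nonneg fun i _ => hR i).1 (h.trans hS0) i
        (Finset.mem_univ i)
      simp [this]
    · have := (Finset.sum_eq_zero_iff_of_nonneg fun j _ => hS j).1 hS0 j (Finset.mem_univ j)
      simp [this]
  | succ N ih =>
    by_cases hpq : ∃ p q, 0 < c p q
    swap
    · push Not at hpq
      exact ih c R S h hc hcut <|
        (Finset.sum_nonpos fun i _ => Finset.sum_nonpos fun j _ => hpq i j).trans (by positivity)
    obtain ⟨p, q, hpq⟩ := hpq
    set e : α → β → ℤ := Pi.single p (Pi.single q 1) with he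
    have he_apply (i j) : e i j = if i = p then (if j = q then 1 else 0) else 0 := by
      by_cases hi : i = p <;> simp [he, Pi.single_apply, hi]
    have he_row (i) : ∑ j, e i j = (Pi.single p 1 : α → ℤ) i := by
      simp only [he_apply, Pi.single_apply]
      split_ifs <;> simp
    have he_col (j) : ∑ i, e i j = (Pi.single q 1 : β → ℤ) j := by
      simp [he_apply, Pi.single_apply]
    have hc' (i j) : 0 ≤ (c - e) i j := by
      have := hc i j
      simp only [Pi.sub_apply, he_apply]
      grind
    have hN' : ∑ i, ∑ j, (c - e) i j ≤ N := by
      simp only [Pi.sub_apply, Finset.sum_sub_distrib, he_row, Finset.sum_pi_single',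
        Finset.mem_univ, if_true]
      push_cast at hN
      linarith
    by_cases hdel : ∀ I J, 0 ≤ cutExcess (c - e) R S I J
    · obtain ⟨A, hA0, hAc, hA⟩ := ih (c - e) R S h hc' hdel hN'
      refine ⟨A, hA0, fun i j => (hAc i j).trans ?_, hA⟩
      simp only [Pi.sub_apply, he_apply]
      grind
    by_cases huse : ∀ I J, 0 ≤ cutExcess (c - e) (R - Pi.single p 1) (S - Pi.single q 1) I J
    · obtain ⟨A, hA0, hAc, hAR, hAS⟩ := ih (c - e) (R - Pi.single p 1) (S - Pi.single q 1)
        (by simp [Finset.sum_sub_distrib, h]) hc' huse hN'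
      refine ⟨A + e, fun i j => ?_, fun i j => ?_, fun i => ?_, fun j => ?_⟩
      · have := hA0 i j
        simp only [Pi.add_apply, he_apply]
        grind
      · have := hAc i j
        simp only [Pi.sub_apply, Pi.add_apply] at this ⊢
        linarith
      · simp [Finset.sum_add_distrib, hAR, he_row]
      · simp [Finset.sum_add_distrib, hAS, he_col]
    push Not at hdel huse
    obtain ⟨I, J, hIJ⟩ := hdel
    obtain ⟨I', J', hIJ'⟩ := huse
    have hsub := cutExcess_submodular hc' R S I I' J J'
    have h₁ := hcut I J
    have h₂ := hcut I' J'
    have h₃ := hcut (I ∪ I') (J ∩ J')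
    have h₄ := hcut (I ∩ I') (J ∪ J')
    rw [cutExcess_sub_single] at hIJ'
    simp only [he, cutExcess_sub_single_capacity, Finset.mem_union, Finset.mem_inter]
      at hIJ hIJ' hsub
    grind

end BoundedMatrix

/-- Gale–Hoffman type existence theorem for nonnegative integral matrices with
prescribed row and column sums and entrywise upper bounds `c`. -/
theorem exists_bounded_matrix_iff {m n : ℕ} (R : Fin m → ℕ) (S : Fin n → ℕ)
    (h : ∑ i, R i = ∑ j, S j) (c : Matrix (Fin m) (Fin n) ℕ) :
    (∃ A : Matrix (Fin m) (Fin n) ℕ,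
        (∀ i j, A i j ≤ c i j) ∧
        (∀ i, ∑ j, A i j = R i) ∧
        (∀ j, ∑ i, A i j = S j)) ↔
      ∀ (I : Finset (Fin m)) (J : Finset (Fin n)),
        (∑ j ∈ J, (S j : ℤ)) - ∑ i ∈ Iᶜ, (R i : ℤ) ≤
          ∑ i ∈ I, ∑ j ∈ J, (c i j : ℤ) := by
  constructor
  · rintro ⟨A, hAc, hAR, hAS⟩ I J
    simp only [← hAR, ← hAS, Nat.cast_sum]
    have hle : ∑ i ∈ I, ∑ j ∈ J, (A i j : ℤ) ≤ ∑ i ∈ I, ∑ j ∈ J, (c i j : ℤ) :=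
      Finset.sum_le_sum fun i _ => Finset.sum_le_sum fun j _ => by exact_mod_cast hAc i j
    have hle' : ∑ i ∈ Iᶜ, ∑ j ∈ J, (A i j : ℤ) ≤ ∑ i ∈ Iᶜ, ∑ j, (A i j : ℤ) :=
      Finset.sum_le_sum fun i _ =>
        Finset.sum_le_sum_of_subset_of_nonneg (Finset.subset_univ J) fun j _ _ => by positivity
    have hsplit := Finset.sum_add_sum_compl I fun i => ∑ j ∈ J, (A i j : ℤ)
    rw [Finset.sum_comm (s := J)]
    linarith
  · intro hcut
    obtain ⟨A, hA0, hAc, hAR, hAS⟩ := exists_int_matrix_of_cutExcess_nonneg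
      (fun i j => (c i j : ℤ)) (fun i => (R i : ℤ)) (fun j => (S j : ℤ)) (by exact_mod_cast h)
      (fun i j => by positivity) (fun I J => by unfold cutExcess; linarith [hcut I J])
    have hcast (i j) : ((A i j).toNat : ℤ) = A i j := Int.toNat_of_nonneg (hA0 i j)
    refine ⟨fun i j => (A i j).toNat, fun i j => ?_, fun i => ?_, fun j => ?_⟩
    · zify
      rw [hcast]
      exact hAc i j
    · zify
      simp only [hcast, hAR]
    · zify
      simp only [hcast, hAS]
end

section
/- Let R=(R_1,…,R_m) and S=(S_1,…,S_n) be partitions of the same weight with m>2 and n>2 such that A(R,S) is nonempty. Let f, f′ be integers with 1 ≤ f < f′ < n and S_f = S_{f+1} = … = S_n = 1. If φ_{2,f} = t_{2,f} and φ_{1,f′} = t_{1,f′}, then ψ_{1,2;f,f′} ≥ t_{1,f′} + t_{2,f}. -/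
open Finset

lemma card_filter_val_lt_le (m k : ℕ) :
    (univ.filter fun i : Fin m => (i : ℕ) < k).card ≤ k := by
  calc (univ.filter fun i : Fin m => (i : ℕ) < k).card
      ≤ (range k).card :=
        card_le_card_of_injOn (fun i => (i : ℕ)) (fun i hi => by simpa using hi)
          (fun i _ j _ h => Fin.ext h)
    _ = k := card_range k

/-- The structure matrix of a nonempty class is nonnegative. -/
lemma structMat_nonneg {m n : ℕ} {R : Fin m → ℕ} {S : Fin n → ℕ}
    (hne : (ARS R S).Nonempty) (k l : ℕ) : 0 ≤ structMat R S k l := by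
  obtain ⟨A, hA, hR, hS⟩ := hne
  have hle (i j) : A i j ≤ 1 := by rcases hA i j with h | h <;> omega
  have key : ∑ j ∈ univ.filter (fun j : Fin n => (j : ℕ) < l), S j ≤
      k * l + ∑ i ∈ univ.filter (fun i : Fin m => k ≤ (i : ℕ)), R i := by
    calc ∑ j ∈ univ.filter (fun j : Fin n => (j : ℕ) < l), S j
        = ∑ i, ∑ j ∈ univ.filter (fun j : Fin n => (j : ℕ) < l), A i j :=
          (sum_congr rfl fun j _ => (hS j).symm).trans sum_comm
      _ = ∑ i ∈ univ.filter (fun i : Fin m => (i : ℕ) < k),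
            ∑ j ∈ univ.filter (fun j : Fin n => (j : ℕ) < l), A i j +
          ∑ i ∈ univ.filter (fun i : Fin m => k ≤ (i : ℕ)),
            ∑ j ∈ univ.filter (fun j : Fin n => (j : ℕ) < l), A i j := by
          rw [← sum_filter_add_sum_filter_not univ (fun i : Fin m => (i : ℕ) < k)]
          simp only [not_lt]
      _ ≤ k * l + ∑ i ∈ univ.filter (fun i : Fin m => k ≤ (i : ℕ)), R i := by
          refine add_le_add ?_ (sum_le_sum fun i _ => ?_)
          · have hrow (i : Fin m) :
                ∑ j ∈ univ.filter (fun j : Fin n => (j : ℕ) < l), A i j ≤ l :=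
              (sum_le_card_nsmul _ _ 1 fun j _ => hle i j).trans
                (by simpa using card_filter_val_lt_le n l)
            exact (sum_le_card_nsmul _ _ l fun i _ => hrow i).trans
              (Nat.mul_le_mul_right l (card_filter_val_lt_le m k))
          · exact (sum_le_sum_of_subset (filter_subset _ _)).trans_eq (hR i)
  have key' := (Nat.cast_le (α := ℤ)).2 key
  push_cast at key'
  unfold structMat
  linarith

lemma structMat_succ {m n : ℕ} (R : Fin m → ℕ) (S : Fin n → ℕ) (k l : ℕ) (hl : l < n) :
    structMat R S k (l + 1) = structMat R S k l + k - S ⟨l, hl⟩ := by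
  have hfilter : univ.filter (fun j : Fin n => (j : ℕ) < l + 1) =
      insert ⟨l, hl⟩ (univ.filter fun j : Fin n => (j : ℕ) < l) := by
    ext j
    simp only [mem_filter, mem_univ, true_and, mem_insert, Fin.ext_iff]
    omega
  unfold structMat
  rw [hfilter, sum_insert (by simp)]
  push_cast
  ring

/-- Along columns of sum `1`, each row of the structure matrix is an arithmetic progression. -/
lemma structMat_add_of_eq_one {m n : ℕ} (R : Fin m → ℕ) (S : Fin n → ℕ) (k l d : ℕ)
    (hS : ∀ j : Fin n, l ≤ (j : ℕ) → S j = 1) (hd : l + d ≤ n) :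
    structMat R S k (l + d) = structMat R S k l + ((k : ℤ) - 1) * d := by
  induction d with
  | zero => simp
  | succ d ih =>
    rw [← add_assoc, structMat_succ R S k (l + d) (by omega), ih (by omega), hS _ (by simp)]
    push_cast
    ring

lemma phi_le {m n : ℕ} {R : Fin m → ℕ} {S : Fin n → ℕ} (hne : (ARS R S).Nonempty)
    {k l i1 i2 j1 j2 : ℕ} (hi1 : i1 ≤ k) (hi2 : k + i2 ≤ m) (hj1 : j1 ≤ l)
    (hj2 : l + j2 ≤ n) :
    phi R S k l ≤ structMat R S i1 (l + j2) + structMat R S (k + i2) j1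
      + ((k : ℤ) - i1) * ((l : ℤ) - j1) := by
  refine csInf_le ⟨0, ?_⟩ ⟨i1, i2, j1, j2, hi1, hi2, hj1, hj2, rfl⟩
  rintro v ⟨i1, i2, j1, j2, hi1, -, hj1, -, rfl⟩
  have hmul : 0 ≤ ((k : ℤ) - i1) * ((l : ℤ) - j1) := mul_nonneg (by omega) (by omega)
  linarith [structMat_nonneg hne i1 (l + j2), structMat_nonneg hne (k + i2) j1]

/-- If `φ_{2,f} = t_{2,f}` and `φ_{1,f'} = t_{1,f'}` with `1 ≤ f < f' < n` and
`S_f = S_{f+1} = … = S_n = 1`, then `ψ_{1,2;f,f'} ≥ t_{1,f'} + t_{2,f}`. -/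
theorem psi_ge_of_phi_eq {m n : ℕ} (R : Fin m → ℕ) (S : Fin n → ℕ)
    (hm : 2 < m) (hn : 2 < n)
    (hRS : IsPartitionPair R S) (hne : (ARS R S).Nonempty)
    (f f' : ℕ) (h1f : 1 ≤ f) (hff' : f < f') (hf'n : f' < n)
    (hS1 : ∀ j : Fin n, f ≤ (j : ℕ) + 1 → S j = 1)
    (hf2 : phi R S 2 f = structMat R S 2 f)
    (hf1 : phi R S 1 f' = structMat R S 1 f') :
    structMat R S 1 f' + structMat R S 2 f ≤ psi R S 1 2 f f' := by
  have hS (j : Fin n) (hj : f ≤ (j : ℕ)) : S j = 1 := hS1 j (by omega)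
  have hS' (j : Fin n) (hj : f' ≤ (j : ℕ)) : S j = 1 := hS1 j (by omega)
  refine le_csInf ⟨_, 0, 0, 0, 0, 0, 0, by omega, by omega, by omega, by omega, by omega,
    by omega, rfl⟩ ?_
  rintro v ⟨i1, i2, i3, j1, j2, j3, hi1, hi2, hi3, hj1, hj2, hj3, rfl⟩
  obtain ⟨d, rfl⟩ := Nat.exists_eq_add_of_le hff'.le
  have hrow1 := structMat_add_of_eq_one R S 1 f d hS (by omega)
  have hrow1' := structMat_add_of_eq_one R S 1 f j2 hS (by omega)
  have hrow1'' := structMat_add_of_eq_one R S 1 (f + d) j3 hS' hj3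
  have hrow2' := structMat_add_of_eq_one R S 2 f j2 hS (by omega)
  have hnonneg := structMat_nonneg hne (2 + i3) j1
  obtain rfl | rfl : i1 = 0 ∨ i1 = 1 := by omega
  · obtain rfl | rfl : i2 = 0 ∨ i2 = 1 := by omega
    · have h := phi_le hne (i1 := 0) (j2 := d + j3) (Nat.zero_le 2) hi3 hj1 (by omega)
      rw [hf2, ← add_assoc] at h
      push_cast at *
      linarith
    · have h := phi_le hne (i1 := 0) (k := 1) (i2 := 1 + i3) (j1 := j1) (j2 := j3)
        (Nat.zero_le 1) (by omega) (by omega) hj3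
      rw [hf1, ← add_assoc] at h
      push_cast at *
      linarith
  · obtain rfl | rfl : i2 = 0 ∨ i2 = 1 := by omega
    · have h := phi_le hne (i1 := 1) (j2 := j2) one_le_two hi3 hj1 (by omega)
      rw [hf2] at h
      push_cast at *
      linarith
    · push_cast at *
      linarith
end

section
/- (Gale–Ryser theorem) Let R=(R_1,…,R_m) and S=(S_1,…,S_n) be partitions of the same weight. Then the class A(R,S) is nonempty if and only if S is majorized by the conjugate partition R* of R, i.e., ∑_{i=1}^{k} S_i ≤ ∑_{i=1}^{k} R*_i for every k = 1,…,n, with equality when k = n. -/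
open Finset

/-- The `j`-th part `R*_j = |{i : R_i ≥ j}|` of the conjugate partition of `R`
(taken to be `0` for `j > R_1`). -/
def conjugatePart {m : ℕ} (R : Fin m → ℕ) (j : ℕ) : ℕ :=
  (Finset.univ.filter fun i : Fin m => j ≤ R i).card

lemma sum_Icc_conjugatePart {m : ℕ} (R : Fin m → ℕ) (k : ℕ) :
    ∑ j ∈ Finset.Icc 1 k, conjugatePart R j = ∑ i, min (R i) k := by
  simp only [conjugatePart, Finset.card_filter]
  rw [Finset.sum_comm]
  refine Finset.sum_congr rfl fun i _ => ?_
  rw [← Finset.card_filter]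
  have h : (Finset.Icc 1 k).filter (fun j => j ≤ R i) = Finset.Icc 1 (min (R i) k) := by
    ext j
    simp only [Finset.mem_filter, Finset.mem_Icc]
    omega
  simp [h]

/-- A column with a larger sum than another contains a `1` in some row where the other
column contains a `0`. -/
lemma IsZeroOne.exists_row_of_colSum_lt {m n : ℕ} {A : Matrix (Fin m) (Fin n) ℕ}
    (hA : IsZeroOne A) {p q : Fin n} (h : ∑ i, A i q < ∑ i, A i p) :
    ∃ r, A r p = 1 ∧ A r q = 0 := by
  obtain ⟨r, -, hr⟩ := Finset.exists_lt_of_sum_lt h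
  refine ⟨r, ?_⟩
  rcases hA r p with h1 | h1 <;> rcases hA r q with h2 | h2 <;> omega

/-- Moving a `1` from column `p` to column `q` within one row of a `(0,1)`-matrix. -/
lemma IsZeroOne.exists_move {m n : ℕ} {A : Matrix (Fin m) (Fin n) ℕ} (hA : IsZeroOne A)
    {p q : Fin n} (h : ∑ i, A i q < ∑ i, A i p) :
    ∃ B : Matrix (Fin m) (Fin n) ℕ, IsZeroOne B ∧ (∀ i, ∑ j, B i j = ∑ j, A i j) ∧
      ∀ j, ∑ i, B i j + (if j = p then 1 else 0) = ∑ i, A i j + (if j = q then 1 else 0) := by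
  obtain ⟨r, hp, hq⟩ := hA.exists_row_of_colSum_lt h
  have hpq : p ≠ q := by rintro rfl; omega
  let B : Matrix (Fin m) (Fin n) ℕ := fun i j =>
    if i = r then (if j = p then 0 else if j = q then 1 else A i j) else A i j
  have hB : ∀ i j, B i j + (if i = r then (if j = p then 1 else 0) else 0)
      = A i j + (if i = r then (if j = q then 1 else 0) else 0) := by
    intro i j
    simp only [B]
    split_ifs <;> simp_all
  refine ⟨B, fun i j => ?_, fun i => ?_, fun j => ?_⟩
  · have := hA i j
    simp only [B]
    split_ifs <;> simp_all
  · have := Finset.sum_congr (rfl : (Finset.univ : Finset (Fin n)) = _) fun j _ => hB i j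
    simp only [Finset.sum_add_distrib] at this
    by_cases hi : i = r <;> simpa [hi] using this
  · have := Finset.sum_congr (rfl : (Finset.univ : Finset (Fin m)) = _) fun i _ => hB i j
    simpa only [Finset.sum_add_distrib, Finset.sum_ite_eq', Finset.mem_univ, if_true] using this

/-- If an antitone vector `S` is dominated, prefix by prefix, by the column sum vector of a
`(0,1)`-matrix `A`, then some `(0,1)`-matrix has the row sums of `A` and column sums `S`. -/
lemma IsZeroOne.nonempty_ARS_of_dominated {m n : ℕ} {S : Fin n → ℕ} (hS : Antitone S)
    {A : Matrix (Fin m) (Fin n) ℕ} (hA : IsZeroOne A)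
    (hdom : ∀ k : ℕ, ∑ j ∈ Finset.univ.filter (fun j : Fin n => (j : ℕ) < k), S j ≤
      ∑ j ∈ Finset.univ.filter (fun j : Fin n => (j : ℕ) < k), ∑ i, A i j)
    (htot : ∑ j, S j = ∑ j, ∑ i, A i j) :
    (ARS (fun i => ∑ j, A i j) S).Nonempty := by
  induction hN : ∑ j, ((∑ i, A i j) - S j) using Nat.strong_induction_on generalizing A with
  | _ N ih =>
  by_cases hge : ∀ j, S j ≤ ∑ i, A i j
  · refine ⟨A, hA, fun _ => rfl, fun j => ?_⟩
    exact ((Finset.sum_eq_sum_iff_of_le fun j _ => hge j).1 htot j (Finset.mem_univ j)).symm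
  obtain ⟨q, hq, hqmin⟩ : ∃ q, ∑ i, A i q < S q ∧ ∀ j < q, S j ≤ ∑ i, A i j := by
    push Not at hge
    obtain ⟨q, hq, hmin⟩ := WellFounded.has_min (wellFounded_lt (α := Fin n))
      {q | ∑ i, A i q < S q} hge
    exact ⟨q, hq, fun j hj => not_lt.1 fun h => hmin j h hj⟩
  obtain ⟨p, hpq, hp⟩ : ∃ p < q, S p < ∑ i, A i p := by
    by_contra! hcon
    refine absurd (hdom (q + 1)) (not_le.2 (Finset.sum_lt_sum (fun j hj => ?_) ⟨q, by simp, hq⟩))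
    rcases (show j ≤ q by simpa [Nat.lt_succ_iff] using hj).eq_or_lt with rfl | hj
    · exact hq.le
    · exact hcon j hj
  obtain ⟨B, hB, hBrow, hBcol⟩ := hA.exists_move (hq.trans_le (hS hpq.le) |>.trans hp)
  have hprefix (s : Finset (Fin n)) :
      ∑ j ∈ s, ∑ i, B i j + (if p ∈ s then 1 else 0)
        = ∑ j ∈ s, ∑ i, A i j + (if q ∈ s then 1 else 0) := by
    have := Finset.sum_congr (rfl : s = s) fun j _ => hBcol j
    simpa only [Finset.sum_add_distrib, Finset.sum_ite_eq'] using this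
  rw [← funext hBrow]
  refine ih _ ?_ hB (fun k => ?_) ?_ rfl
  · rw [← hN]
    refine Finset.sum_lt_sum (fun j _ => ?_) ⟨p, Finset.mem_univ p, ?_⟩
    · have := hBcol j
      by_cases hj : j = q
      · subst hj
        rw [if_neg hpq.ne', if_pos rfl] at this
        omega
      · rw [if_neg hj] at this
        omega
    · have := hBcol p
      rw [if_pos rfl, if_neg hpq.ne] at this
      omega
  · have h1 := hprefix (Finset.univ.filter fun j : Fin n => (j : ℕ) < k)
    have h2 := hdom k
    simp only [Finset.mem_filter, Finset.mem_univ, true_and] at h1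
    by_cases hqk : (q : ℕ) < k
    · rw [if_pos hqk, if_pos (lt_trans (Fin.lt_def.1 hpq) hqk)] at h1
      omega
    by_cases hpk : (p : ℕ) < k
    · rw [if_pos hpk, if_neg hqk] at h1
      have h3 := Finset.sum_lt_sum (s := Finset.univ.filter fun j : Fin n => (j : ℕ) < k)
        (fun j hj => hqmin j (Fin.lt_def.2 (by simp at hj; omega))) ⟨p, by simpa using hpk, hp⟩
      omega
    · rw [if_neg hpk, if_neg hqk] at h1
      omega
  · have := hprefix Finset.univ
    simp only [Finset.mem_univ, if_true] at this
    omega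

/-- Gale–Ryser theorem: `𝒜(R,S)` is nonempty iff `S` is majorized by the
conjugate partition `R*` of `R`. -/
theorem gale_ryser {m n : ℕ} (R : Fin m → ℕ) (S : Fin n → ℕ)
    (hRS : IsPartitionPair R S) :
    (ARS R S).Nonempty ↔
      ((∀ k : ℕ, 1 ≤ k → k ≤ n →
          ∑ j ∈ Finset.univ.filter (fun j : Fin n => (j : ℕ) < k), S j ≤
            ∑ i ∈ Finset.Icc 1 k, conjugatePart R i) ∧
        ∑ j, S j = ∑ i ∈ Finset.Icc 1 n, conjugatePart R i) := by
  have hSanti := hRS.2.2.1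
  have hweight := hRS.2.2.2.2
  simp only [sum_Icc_conjugatePart]
  constructor
  · rintro ⟨A, hA, hrow, hcol⟩
    have hle : ∀ i (s : Finset (Fin n)), ∑ j ∈ s, A i j ≤ s.card := fun i s => by
      simpa using Finset.sum_le_card_nsmul s (A i) 1 fun j _ => by
        rcases hA i j with h | h <;> omega
    refine ⟨fun k _ hk => ?_, ?_⟩
    · simp only [← hcol]
      rw [Finset.sum_comm]
      refine Finset.sum_le_sum fun i _ => le_min ?_ ?_
      · rw [← hrow i]
        exact Finset.sum_le_sum_of_subset (Finset.filter_subset _ _)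
      · exact (hle i _).trans (by simp [Fin.card_filter_val_lt])
    · rw [← hweight]
      refine Finset.sum_congr rfl fun i _ => (min_eq_left ?_).symm
      rw [← hrow i]
      simpa using hle i Finset.univ
  · rintro ⟨hdom, htot⟩
    have hRn : ∀ i, min (R i) n = R i := fun i =>
      (Finset.sum_eq_sum_iff_of_le fun i _ => min_le_left (R i) n).1
        (htot.symm.trans hweight.symm) i (Finset.mem_univ i)
    let A : Matrix (Fin m) (Fin n) ℕ := fun i j => if (j : ℕ) < R i then 1 else 0
    have hA : IsZeroOne A := fun i j => by
      simp only [A]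
      split_ifs <;> simp
    have hArow : ∀ i, ∑ j, A i j = R i := fun i => by
      simp only [A, ← Finset.card_filter, Fin.card_filter_val_lt]
      rw [min_comm, hRn i]
    have hAcol : ∀ k : ℕ, k ≤ n →
        ∑ j ∈ Finset.univ.filter (fun j : Fin n => (j : ℕ) < k), ∑ i, A i j
          = ∑ i, min (R i) k := fun k hk => by
      rw [Finset.sum_comm]
      refine Finset.sum_congr rfl fun i _ => ?_
      simp only [A, ← Finset.card_filter, Finset.filter_filter, ← lt_min_iff,
        Fin.card_filter_val_lt]
      omega
    have hAtot : ∑ j, S j = ∑ j, ∑ i, A i j := by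
      rw [Finset.sum_comm, ← hweight]
      exact Finset.sum_congr rfl fun i _ => (hArow i).symm
    rw [← funext hArow]
    refine hA.nonempty_ARS_of_dominated hSanti (fun k => ?_) hAtot
    rcases le_or_gt k n with hk | hk
    · rcases Nat.eq_zero_or_pos k with rfl | hk0
      · simp
      · rw [hAcol k hk]
        exact hdom k hk0 hk
    · have huniv : Finset.univ.filter (fun j : Fin n => (j : ℕ) < k) = Finset.univ :=
        Finset.filter_true_of_mem fun j _ => j.2.trans hk
      rw [huniv]
      exact hAtot.le
end

section
/- (Ford–Fulkerson criterion) Let R=(R_1,…,R_m) and S=(S_1,…,S_n) be partitions of the same weight, and let T=[t_{k,l}] be the structure matrix associated with R and S. Then the class A(R,S) is nonempty if and only if every entry of T is nonnegative, i.e., t_{k,l} ≥ 0 for all 0 ≤ k ≤ m and 0 ≤ l ≤ n. -/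
open Finset

/-- Among all subfamilies of `k` terms of an antitone family, the first `k` terms have the
largest sum. -/
theorem sum_le_sum_filter_lt_card {m : ℕ} {R : Fin m → ℕ} (hR : Antitone R)
    (I : Finset (Fin m)) :
    ∑ i ∈ I, R i ≤ ∑ i ∈ univ.filter (fun i : Fin m => (i : ℕ) < I.card), R i := by
  have hcard : I.card ≤ m := by simpa using I.card_le_univ
  have hle : ∀ (a : ℕ) (ha : a < I.card), a ≤ (I.orderEmbOfFin rfl ⟨a, ha⟩ : ℕ) := by
    intro a
    induction a with
    | zero => intro _; exact Nat.zero_le _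
    | succ a ih =>
      intro ha
      have hlt : I.orderEmbOfFin rfl ⟨a, by omega⟩ < I.orderEmbOfFin rfl ⟨a + 1, ha⟩ :=
        (I.orderEmbOfFin rfl).strictMono (by simp [Fin.lt_def])
      have := ih (by omega)
      rw [Fin.lt_def] at hlt
      omega
  have hI : ∑ i ∈ I, R i = ∑ x : Fin I.card, R (I.orderEmbOfFin rfl x) := by
    conv_lhs => rw [← I.map_orderEmbOfFin_univ rfl]
    rw [sum_map]
    rfl
  have hfirst : ∑ i ∈ univ.filter (fun i : Fin m => (i : ℕ) < I.card), R i
      = ∑ x : Fin I.card, R (Fin.castLE hcard x) := by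
    have hmap : univ.filter (fun i : Fin m => (i : ℕ) < I.card)
        = univ.map (Fin.castLEEmb hcard) := by
      ext i
      simp only [mem_filter, mem_univ, true_and, mem_map, Fin.castLEEmb_apply]
      exact ⟨fun h => ⟨⟨i, h⟩, rfl⟩, by rintro ⟨x, rfl⟩; exact x.2⟩
    rw [hmap, sum_map]
    rfl
  rw [hI, hfirst]
  exact sum_le_sum fun x _ => hR (hle x x.2)

/-- In a `(0,1)`-matrix, the `1`'s in the columns `J` lie in the block `I × J` or in a row
outside `I`. -/
theorem sum_col_le_of_mem_ARS {m n : ℕ} {R : Fin m → ℕ} {S : Fin n → ℕ}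
    {A : Matrix (Fin m) (Fin n) ℕ} (hA : A ∈ ARS R S)
    (I : Finset (Fin m)) (J : Finset (Fin n)) :
    ∑ j ∈ J, S j ≤ I.card * J.card + ∑ i ∈ Iᶜ, R i := by
  obtain ⟨h01, hrow, hcol⟩ := hA
  have hle : ∀ i j, A i j ≤ 1 := fun i j => by rcases h01 i j with h | h <;> omega
  calc ∑ j ∈ J, S j = ∑ i, ∑ j ∈ J, A i j :=
        (sum_congr rfl fun j _ => (hcol j).symm).trans sum_comm
    _ = ∑ i ∈ I, ∑ j ∈ J, A i j + ∑ i ∈ Iᶜ, ∑ j ∈ J, A i j := (sum_add_sum_compl _ _).symm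
    _ ≤ I.card * J.card + ∑ i ∈ Iᶜ, R i := by
        refine Nat.add_le_add ?_ (sum_le_sum fun i _ => ?_)
        · calc ∑ i ∈ I, ∑ j ∈ J, A i j ≤ ∑ _i ∈ I, ∑ _j ∈ J, 1 :=
                sum_le_sum fun i _ => sum_le_sum fun j _ => hle i j
            _ = I.card * J.card := by simp
        · rw [← hrow i]
          exact sum_le_sum_of_subset (subset_univ J)

/-- Hall's theorem, applied to the assignment of each cell `(i, j)` either to one of `S j` slots
for the `1`'s of column `j` or to one of `n - R i` slots for the `0`'s of row `i`. -/
theorem ARS_nonempty_of_card_mul_card_le {m n : ℕ} {R : Fin m → ℕ} {S : Fin n → ℕ}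
    (hsum : ∑ i, R i = ∑ j, S j) (hRn : ∀ i, R i ≤ n)
    (h : ∀ (I : Finset (Fin m)) (J : Finset (Fin n)),
      I.card * J.card ≤ ∑ j ∈ J, S j + ∑ i ∈ I, (n - R i)) :
    (ARS R S).Nonempty := by
  classical
  let slots (I : Finset (Fin m)) (J : Finset (Fin n)) :
      Finset ((Σ j : Fin n, Fin (S j)) ⊕ (Σ i : Fin m, Fin (n - R i))) :=
    (J.sigma fun _ => univ).disjSum (I.sigma fun _ => univ)
  have hslots : ∀ I J, (slots I J).card = ∑ j ∈ J, S j + ∑ i ∈ I, (n - R i) := by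
    intro I J
    simp [slots, card_disjSum, card_sigma]
  obtain ⟨f, hf, hmem⟩ := (Finset.all_card_le_biUnion_card_iff_exists_injective
    (fun c : Fin m × Fin n => slots {c.1} {c.2})).1 (by
      intro W
      have hW : W ⊆ W.image Prod.fst ×ˢ W.image Prod.snd := fun c hc =>
        mem_product.2 ⟨mem_image_of_mem _ hc, mem_image_of_mem _ hc⟩
      have hN : slots (W.image Prod.fst) (W.image Prod.snd)
          ⊆ W.biUnion fun c => slots {c.1} {c.2} := by
        rintro (⟨j, x⟩ | ⟨i, x⟩) hx
        · simp only [slots, inl_mem_disjSum, mem_sigma, mem_image, mem_univ, and_true] at hx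
          obtain ⟨c, hc, rfl⟩ := hx
          exact mem_biUnion.2 ⟨c, hc, by simp [slots]⟩
        · simp only [slots, inr_mem_disjSum, mem_sigma, mem_image, mem_univ, and_true] at hx
          obtain ⟨c, hc, rfl⟩ := hx
          exact mem_biUnion.2 ⟨c, hc, by simp [slots]⟩
      calc W.card ≤ (W.image Prod.fst).card * (W.image Prod.snd).card := by
            simpa [card_product] using card_le_card hW
        _ ≤ (slots (W.image Prod.fst) (W.image Prod.snd)).card := by
            rw [hslots]
            exact h _ _
        _ ≤ _ := card_le_card hN)
  let A : Matrix (Fin m) (Fin n) ℕ := fun i j => if (f (i, j)).isLeft then 1 else 0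
  have hcol : ∀ j, ∑ i, A i j ≤ S j := by
    intro j
    have hS : ((slots ∅ {j}).card) = S j := by simp [hslots]
    rw [← hS]
    simp only [A, sum_boole, Nat.cast_id]
    refine card_le_card_of_injOn (fun i => f (i, j)) (fun i hi => ?_)
      (fun a _ b _ hab => congrArg Prod.fst (hf hab))
    have hc := hmem (i, j)
    simp only [coe_filter, mem_univ, true_and, Set.mem_ofPred_eq] at hi
    obtain ⟨x, hx⟩ := Sum.isLeft_iff.1 hi
    simp only [slots, hx, inl_mem_disjSum, mem_coe] at hc ⊢
    exact hc
  have hrow : ∀ i, R i ≤ ∑ j, A i j := by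
    intro i
    have hzero : (univ.filter fun j => ¬ (f (i, j)).isLeft).card ≤ n - R i := by
      have hS : ((slots {i} ∅).card) = n - R i := by simp [hslots]
      rw [← hS]
      refine card_le_card_of_injOn (fun j => f (i, j)) (fun j hj => ?_)
        (fun a _ b _ hab => congrArg Prod.snd (hf hab))
      have hc := hmem (i, j)
      simp only [coe_filter, mem_univ, true_and, Set.mem_ofPred_eq, Sum.not_isLeft] at hj
      obtain ⟨x, hx⟩ := Sum.isRight_iff.1 hj
      simp only [slots, hx, inr_mem_disjSum, mem_coe] at hc ⊢
      exact hc
    have htotal := card_filter_add_card_filter_not (s := (univ : Finset (Fin n)))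
      (fun j => ((f (i, j)).isLeft : Prop))
    rw [card_univ, Fintype.card_fin] at htotal
    have := hRn i
    simp only [A, sum_boole, Nat.cast_id]
    omega
  have hswap : ∑ i, ∑ j, A i j = ∑ j, ∑ i, A i j := sum_comm
  have hR_le : ∑ i, R i ≤ ∑ i, ∑ j, A i j := sum_le_sum fun i _ => hrow i
  have hle_S : ∑ j, ∑ i, A i j ≤ ∑ j, S j := sum_le_sum fun j _ => hcol j
  refine ⟨A, fun i j => ?_, fun i => ?_, fun j => ?_⟩
  · by_cases hl : (f (i, j)).isLeft <;> simp [A, hl]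
  · exact ((sum_eq_sum_iff_of_le fun i _ => hrow i).1 (by omega) i (mem_univ i)).symm
  · exact (sum_eq_sum_iff_of_le fun j _ => hcol j).1 (by omega) j (mem_univ j)

theorem structMat_nonneg_iff {m n : ℕ} (R : Fin m → ℕ) (S : Fin n → ℕ) (k l : ℕ) :
    0 ≤ structMat R S k l ↔
      ∑ j ∈ univ.filter (fun j : Fin n => (j : ℕ) < l), S j
        ≤ k * l + ∑ i ∈ (univ.filter (fun i : Fin m => (i : ℕ) < k))ᶜ, R i := by
  have hcompl : (univ.filter (fun i : Fin m => (i : ℕ) < k))ᶜ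
      = univ.filter (fun i : Fin m => k ≤ (i : ℕ)) := by
    ext i
    simp
  rw [hcompl, structMat]
  zify
  constructor <;> intro h <;> linarith

/-- Ford–Fulkerson criterion: `𝒜(R,S)` is nonempty iff every entry of the
structure matrix `T` associated with `R` and `S` is nonnegative. -/
theorem ford_fulkerson {m n : ℕ} (R : Fin m → ℕ) (S : Fin n → ℕ)
    (hRS : IsPartitionPair R S) :
    (ARS R S).Nonempty ↔
      ∀ k l : ℕ, k ≤ m → l ≤ n → 0 ≤ structMat R S k l := by
  simp only [structMat_nonneg_iff]
  obtain ⟨hR, -, hS, -, hsum⟩ := hRS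
  constructor
  · rintro ⟨A, hA⟩ k l hk hl
    simpa [Fin.card_filter_val_lt, hk, hl] using sum_col_le_of_mem_ARS hA
      (univ.filter fun i : Fin m => (i : ℕ) < k) (univ.filter fun j : Fin n => (j : ℕ) < l)
  · intro h
    have key : ∀ (I : Finset (Fin m)) (J : Finset (Fin n)),
        I.card * J.card + ∑ i ∈ I, R i ≤ ∑ j ∈ J, S j + I.card * n := by
      intro I J
      have hI : I.card ≤ m := by simpa using I.card_le_univ
      have hJ : Jᶜ.card ≤ n := by simpa using Jᶜ.card_le_univ
      have hJcard : J.card + Jᶜ.card = n := by simp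
      have ht := h I.card Jᶜ.card hI hJ
      have hRle := sum_le_sum_filter_lt_card hR I
      have hSle := sum_le_sum_filter_lt_card hS Jᶜ
      have hRtotal := sum_add_sum_compl (univ.filter fun i : Fin m => (i : ℕ) < I.card) R
      have hStotal := sum_add_sum_compl J S
      have hmul : I.card * n = I.card * J.card + I.card * Jᶜ.card := by
        rw [← Nat.mul_add, hJcard]
      omega
    have hRn : ∀ i, R i ≤ n := fun i => by simpa using key {i} ∅
    refine ARS_nonempty_of_card_mul_card_le hsum hRn fun I J => ?_
    have hzeros : ∑ i ∈ I, (n - R i) + ∑ i ∈ I, R i = I.card * n := by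
      rw [← sum_add_distrib, sum_congr rfl fun i _ => Nat.sub_add_cancel (hRn i)]
      simp
    have := key I J
    omega
end
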